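/- If m ≥ 4, then every A ∈ K₋ can be written uniquely as A = A₀ + σ₂φ + σ₄ψ where A₀ ∈ K₋ ∩ ker(ρ), φ ∈ S²₋, and ψ ∈ Λ²₋; that is, K₋ is the internal direct sum of the subspaces K₋ ∩ ker(ρ), σ₂(S²₋), and σ₄(Λ²₋). -/

import Mathlib

open Module

variable {V : Type*} [AddCommGroup V] [Module ℝ V]

/-- `A` is an affine curvature operator. -/
def IsAff (A : V →ₗ[ℝ] V →ₗ[ℝ] V →ₗ[ℝ] V) : Prop :=
  (∀ x y, A x y = - A y x) ∧ ∀ x y z, A x y z + A y z x + A z x y = 0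

/-- The Ricci tensor `ρ(A)(x,y) = Tr (z ↦ A(z,x)y)`. -/
noncomputable def rho (A : V →ₗ[ℝ] V →ₗ[ℝ] V →ₗ[ℝ] V) (x y : V) : ℝ :=
  LinearMap.trace ℝ V ((A.flip x).flip y)

/-- `A` is an affine Kähler curvature operator: `A ∈ 𝔄` and `A(x,y)` commutes with `J`. -/
def IsK (J : V →ₗ[ℝ] V) (A : V →ₗ[ℝ] V →ₗ[ℝ] V →ₗ[ℝ] V) : Prop :=
  IsAff A ∧ ∀ x y z, A x y (J z) = J (A x y z)

/-- `A ∈ K₋`. -/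
def IsKminus (J : V →ₗ[ℝ] V) (A : V →ₗ[ℝ] V →ₗ[ℝ] V →ₗ[ℝ] V) : Prop :=
  IsK J A ∧ ∀ x y, A (J x) (J y) = - A x y

/-- `A = A₀ + σ₂φ + σ₄ψ` is a decomposition of `A` with `A₀ ∈ K₋ ∩ ker ρ`, `φ ∈ S²₋`
and `ψ ∈ Λ²₋`, where `(σ₂φ)(x,y)z = φ(x,z)y − φ(y,z)x − φ(x,Jz)Jy + φ(y,Jz)Jx`
and `(σ₄ψ)(x,y)z = ψ(x,z)y − ψ(y,z)x + 2ψ(x,y)z − ψ(x,Jz)Jy + ψ(y,Jz)Jx − 2ψ(x,Jy)Jz`. -/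
def DecompMinus (J : V →ₗ[ℝ] V) (A A₀ : V →ₗ[ℝ] V →ₗ[ℝ] V →ₗ[ℝ] V)
    (φ ψ : V →ₗ[ℝ] V →ₗ[ℝ] ℝ) : Prop :=
  IsKminus J A₀ ∧ (∀ x y, rho A₀ x y = 0) ∧
  (∀ x y, φ x y = φ y x) ∧ (∀ x y, φ (J x) (J y) = - φ x y) ∧
  (∀ x y, ψ x y = - ψ y x) ∧ (∀ x y, ψ (J x) (J y) = - ψ x y) ∧
  ∀ x y z, A x y z = A₀ x y z
    + (φ x z • y - φ y z • x - φ x (J z) • J y + φ y (J z) • J x)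
    + (ψ x z • y - ψ y z • x + (2 * ψ x y) • z - ψ x (J z) • J y + ψ y (J z) • J x
        - (2 * ψ x (J y)) • J z)

/-- Helper: a bilinear-form version of `σ₂`. -/
noncomputable def sig2 (J : V →ₗ[ℝ] V) (φ : V →ₗ[ℝ] V →ₗ[ℝ] ℝ) :
    V →ₗ[ℝ] V →ₗ[ℝ] V →ₗ[ℝ] V :=
  LinearMap.mk₂ ℝ (fun x y => (φ x).smulRight y - (φ y).smulRight x
      - ((φ x).comp J).smulRight (J y) + ((φ y).comp J).smulRight (J x))
    (by intros; ext; simp; module) (by intros; ext; simp; module)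
    (by intros; ext; simp; module) (by intros; ext; simp; module)

/-- Helper: the extra terms of `σ₄`. -/
noncomputable def sig4' (J : V →ₗ[ℝ] V) (ψ : V →ₗ[ℝ] V →ₗ[ℝ] ℝ) :
    V →ₗ[ℝ] V →ₗ[ℝ] V →ₗ[ℝ] V :=
  LinearMap.mk₂ ℝ (fun x y => (2 * ψ x y) • LinearMap.id - (2 * ψ x (J y)) • J)
    (by intros; ext; simp; module) (by intros; ext; simp; module)
    (by intros; ext; simp; module) (by intros; ext; simp; module)

/-- Helper: the sum `σ₂φ + σ₄ψ`. -/
noncomputable def sigg (J : V →ₗ[ℝ] V) (φ ψ : V →ₗ[ℝ] V →ₗ[ℝ] ℝ) :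
    V →ₗ[ℝ] V →ₗ[ℝ] V →ₗ[ℝ] V := sig2 J φ + (sig2 J ψ + sig4' J ψ)

lemma sigg_apply (J : V →ₗ[ℝ] V) (φ ψ : V →ₗ[ℝ] V →ₗ[ℝ] ℝ) (x y z : V) :
    sigg J φ ψ x y z = (φ x z • y - φ y z • x - φ x (J z) • J y + φ y (J z) • J x)
    + (ψ x z • y - ψ y z • x + (2 * ψ x y) • z - ψ x (J z) • J y + ψ y (J z) • J x
        - (2 * ψ x (J y)) • J z) := by
  simp [sigg, sig2, sig4']; module

lemma traceJ [FiniteDimensional ℝ V] (J : V →ₗ[ℝ] V) (hJ : ∀ v, J (J v) = -v) :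
    LinearMap.trace ℝ V J = 0 := by
  have hJJ : (J : Module.End ℝ V) * J = -1 := by ext v; simp [hJ]
  let _ : Module ℂ V := Module.compHom V
    (Complex.liftAux (A := Module.End ℝ V) J hJJ).toRingHom
  have hs : ∀ (c : ℂ) (v : V), c • v = c.re • v + c.im • J v := fun c v => by
    change (Complex.liftAux (A := Module.End ℝ V) J hJJ) c v = _
    rw [Complex.liftAux_apply]; simp
  have : IsScalarTower ℝ ℂ V := ⟨fun r c v => by
    rw [hs, hs]; simp [mul_smul]⟩
  have : Module.Finite ℂ V := Module.Finite.of_restrictScalars_finite ℝ ℂ V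
  have hJI : ∀ v, J v = Complex.I • v := fun v => by rw [hs]; simp
  let b := Module.finBasis ℂ V
  rw [LinearMap.trace_eq_matrix_trace ℝ (Complex.basisOneI.smulTower b), Matrix.trace]
  apply Finset.sum_eq_zero
  rintro ⟨i, j⟩ -
  rw [Matrix.diag_apply, LinearMap.toMatrix_apply, Module.Basis.smulTower_repr,
    Module.Basis.smulTower_apply, hJI]
  fin_cases i <;> simp

lemma swapJ (J : V →ₗ[ℝ] V) (hJ : ∀ v, J (J v) = -v) (φ : V →ₗ[ℝ] V →ₗ[ℝ] ℝ)
    (h : ∀ x y, φ (J x) (J y) = - φ x y) (x y : V) : φ (J x) y = φ x (J y) := by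
  have := h x (J y)
  rw [hJ] at this; simpa using this

lemma rho_sigg [FiniteDimensional ℝ V] (J : V →ₗ[ℝ] V) (hJ : ∀ v, J (J v) = -v)
    (φ ψ : V →ₗ[ℝ] V →ₗ[ℝ] ℝ)
    (h2 : ∀ x y, φ (J x) (J y) = - φ x y)
    (h3 : ∀ x y, ψ x y = - ψ y x) (h4 : ∀ x y, ψ (J x) (J y) = - ψ x y) (x y : V) :
    rho (sigg J φ ψ) x y = (2 - (finrank ℝ V : ℝ)) * φ x y
      - (finrank ℝ V + 2 : ℝ) * ψ x y := by
  have e : ((sigg J φ ψ).flip x).flip y =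
      (φ.flip y).smulRight x - φ x y • LinearMap.id - (φ.flip (J y)).smulRight (J x)
      + φ x (J y) • J + ((ψ.flip y).smulRight x - ψ x y • LinearMap.id
      + (2:ℝ) • (ψ.flip x).smulRight y - (ψ.flip (J y)).smulRight (J x)
      + ψ x (J y) • J - (2:ℝ) • (ψ.flip (J x)).smulRight (J y)) := by
    ext z
    simp [sigg_apply]; module
  rw [rho, e]
  simp only [map_add, map_sub, map_smul, LinearMap.trace_smulRight, LinearMap.trace_id,
    traceJ J hJ, LinearMap.flip_apply, h2, h4, smul_eq_mul]
  rw [h3 y x]; ring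

lemma rho_add (A B : V →ₗ[ℝ] V →ₗ[ℝ] V →ₗ[ℝ] V) (x y : V) :
    rho (A + B) x y = rho A x y + rho B x y := by
  simp only [rho]; rw [← map_add]; rfl

lemma rho_sub (A B : V →ₗ[ℝ] V →ₗ[ℝ] V →ₗ[ℝ] V) (x y : V) :
    rho (A - B) x y = rho A x y - rho B x y := by
  simp only [rho]; rw [← map_sub]; rfl

/-- Helper: the Ricci tensor as a bilinear map. -/
noncomputable def rhoL (A : V →ₗ[ℝ] V →ₗ[ℝ] V →ₗ[ℝ] V) : V →ₗ[ℝ] V →ₗ[ℝ] ℝ :=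
  LinearMap.mk₂ ℝ (rho A)
    (by intro a b c; simp only [rho]; rw [← map_add]; congr 1; ext; simp)
    (by intro a b c; simp only [rho]; rw [← map_smul]; congr 1; ext; simp)
    (by intro a b c; simp only [rho]; rw [← map_add]; congr 1; ext; simp)
    (by intro a b c; simp only [rho]; rw [← map_smul]; congr 1; ext; simp)

lemma rho_J [FiniteDimensional ℝ V] (J : V →ₗ[ℝ] V) (hJ : ∀ v, J (J v) = -v)
    (A : V →ₗ[ℝ] V →ₗ[ℝ] V →ₗ[ℝ] V) (hA : IsKminus J A) (x y : V) :
    rho A (J x) (J y) = - rho A x y := by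
  obtain ⟨⟨-, hK⟩, hm⟩ := hA
  have e : (A.flip (J x)).flip (J y) = J ∘ₗ (((A.flip x).flip y) ∘ₗ J) := by
    ext z
    have := hm (J z) x
    rw [hJ] at this
    simp only [map_neg, LinearMap.neg_apply, neg_inj] at this
    simp [hK, this]
  have e2 : (((A.flip x).flip y) ∘ₗ J) ∘ₗ J = - ((A.flip x).flip y) := by
    ext z; simp [hJ]
  rw [rho, e, LinearMap.trace_comp_comm', e2, map_neg, rho]

lemma sigg_K (J : V →ₗ[ℝ] V) (hJ : ∀ v, J (J v) = -v)
    (φ ψ : V →ₗ[ℝ] V →ₗ[ℝ] ℝ) (h1 : ∀ x y, φ x y = φ y x)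
    (h2 : ∀ x y, φ (J x) (J y) = - φ x y)
    (h3 : ∀ x y, ψ x y = - ψ y x) (h4 : ∀ x y, ψ (J x) (J y) = - ψ x y) :
    IsKminus J (sigg J φ ψ) := by
  have s2 := swapJ J hJ φ h2
  have s4 := swapJ J hJ ψ h4
  have h3' : ∀ x y, ψ x (J y) = - ψ y (J x) := fun x y => by rw [h3, s4]
  have h1' : ∀ x y, φ x (J y) = φ y (J x) := fun x y => by rw [h1, s2]
  refine ⟨⟨⟨fun x y => ?_, fun x y z => ?_⟩, fun x y z => ?_⟩, fun x y => ?_⟩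
  · ext z
    simp only [sigg_apply, LinearMap.neg_apply]
    rw [h3 y x, h3' y x]; module
  · simp only [sigg_apply]
    rw [h1 y x, h1 z x, h1 z y, h1' y x, h1' z x, h1' z y,
      h3 y x, h3 z x, h3 z y, h3' y x, h3' z x, h3' z y]; module
  · simp only [sigg_apply, hJ, map_add, map_sub, map_smul, map_neg]
    module
  · ext z
    simp only [sigg_apply, hJ, LinearMap.neg_apply, h2, h4, s2, s4, map_neg]
    module

lemma Kminus_sub (J : V →ₗ[ℝ] V) (A B : V →ₗ[ℝ] V →ₗ[ℝ] V →ₗ[ℝ] V)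
    (hA : IsKminus J A) (hB : IsKminus J B) : IsKminus J (A - B) := by
  obtain ⟨⟨⟨a1, a2⟩, a3⟩, a4⟩ := hA
  obtain ⟨⟨⟨b1, b2⟩, b3⟩, b4⟩ := hB
  refine ⟨⟨⟨fun x y => ?_, fun x y z => ?_⟩, fun x y z => ?_⟩, fun x y => ?_⟩
  · simp only [LinearMap.sub_apply]; rw [a1, b1]; abel
  · have := congrArg₂ (· - ·) (a2 x y z) (b2 x y z)
    simp only [sub_zero] at this
    simp only [LinearMap.sub_apply]; rw [← this]; abel
  · simp only [LinearMap.sub_apply, a3, b3, map_sub]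
  · simp only [LinearMap.sub_apply, a4, b4]; abel

/-- if `m ≥ 4`, every `A ∈ K₋` decomposes uniquely as
`A = A₀ + σ₂φ + σ₄ψ` with `A₀ ∈ K₋ ∩ ker ρ`, `φ ∈ S²₋`, `ψ ∈ Λ²₋`. -/
theorem statement5 [FiniteDimensional ℝ V] (J : V →ₗ[ℝ] V) (hJ : ∀ v, J (J v) = -v)
    (hm : 4 ≤ finrank ℝ V) :
    ∀ A : V →ₗ[ℝ] V →ₗ[ℝ] V →ₗ[ℝ] V, IsKminus J A →
      (∃ A₀ : V →ₗ[ℝ] V →ₗ[ℝ] V →ₗ[ℝ] V, ∃ φ ψ : V →ₗ[ℝ] V →ₗ[ℝ] ℝ,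
        DecompMinus J A A₀ φ ψ) ∧
      (∀ A₀ A₀' : V →ₗ[ℝ] V →ₗ[ℝ] V →ₗ[ℝ] V, ∀ φ ψ φ' ψ' : V →ₗ[ℝ] V →ₗ[ℝ] ℝ,
        DecompMinus J A A₀ φ ψ → DecompMinus J A A₀' φ' ψ' →
        A₀ = A₀' ∧ φ = φ' ∧ ψ = ψ') := by
  intro A hA
  have hm' : (4:ℝ) ≤ finrank ℝ V := by exact_mod_cast hm
  have n1 : (2 - (finrank ℝ V : ℝ)) ≠ 0 := by linarith
  have n2 : (finrank ℝ V + 2 : ℝ) ≠ 0 := by linarith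
  have key : ∀ A₀ φ ψ, DecompMinus J A A₀ φ ψ → A = A₀ + sigg J φ ψ ∧
      (∀ x y, rho A x y = (2 - (finrank ℝ V : ℝ)) * φ x y
      - (finrank ℝ V + 2 : ℝ) * ψ x y) := by
    rintro A₀ φ ψ ⟨-, h0, -, h2, h3, h4, h⟩
    have e : A = A₀ + sigg J φ ψ := by
      ext x y z
      rw [h, LinearMap.add_apply, LinearMap.add_apply, LinearMap.add_apply, sigg_apply]; abel
    refine ⟨e, fun x y => ?_⟩
    rw [e, rho_add, h0, rho_sigg J hJ φ ψ h2 h3 h4, zero_add]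
  constructor
  · set φ : V →ₗ[ℝ] V →ₗ[ℝ] ℝ :=
      (2 * (2 - (finrank ℝ V : ℝ)))⁻¹ • (rhoL A + (rhoL A).flip) with hφ
    set ψ : V →ₗ[ℝ] V →ₗ[ℝ] ℝ :=
      (-(2 * (finrank ℝ V + 2 : ℝ))⁻¹) • (rhoL A - (rhoL A).flip) with hψ
    have eφ : ∀ x y, φ x y = (2 * (2 - (finrank ℝ V : ℝ)))⁻¹ * (rho A x y + rho A y x) :=
      fun x y => by simp [hφ, rhoL]; ring
    have eψ : ∀ x y, ψ x y = (-(2 * (finrank ℝ V + 2 : ℝ))⁻¹) * (rho A x y - rho A y x) :=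
      fun x y => by simp [hψ, rhoL]
    have h1 : ∀ x y, φ x y = φ y x := fun x y => by rw [eφ, eφ]; ring
    have h3 : ∀ x y, ψ x y = - ψ y x := fun x y => by rw [eψ, eψ]; ring
    have h2 : ∀ x y, φ (J x) (J y) = - φ x y := fun x y => by
      rw [eφ, eφ, rho_J J hJ A hA, rho_J J hJ A hA]; ring
    have h4 : ∀ x y, ψ (J x) (J y) = - ψ x y := fun x y => by
      rw [eψ, eψ, rho_J J hJ A hA, rho_J J hJ A hA]; ring
    refine ⟨A - sigg J φ ψ, φ, ψ, Kminus_sub J _ _ hA (sigg_K J hJ φ ψ h1 h2 h3 h4),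
      fun x y => ?_, h1, h2, h3, h4, fun x y z => ?_⟩
    · rw [rho_sub, rho_sigg J hJ φ ψ h2 h3 h4, eφ, eψ]
      field_simp; ring
    · rw [LinearMap.sub_apply, LinearMap.sub_apply, LinearMap.sub_apply, sigg_apply]; abel
  · intro A₀ A₀' φ ψ φ' ψ' d d'
    obtain ⟨e, r⟩ := key _ _ _ d
    obtain ⟨e', r'⟩ := key _ _ _ d'
    obtain ⟨-, -, s, -, a, -, -⟩ := d
    obtain ⟨-, -, s', -, a', -, -⟩ := d'
    have hφ : φ = φ' := by
      ext x y
      apply mul_left_cancel₀ n1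
      have q1 := r x y
      have q2 := r y x
      have q3 := r' x y
      have q4 := r' y x
      rw [s y x, a y x] at q2
      rw [s' y x, a' y x] at q4
      linarith
    have hψ : ψ = ψ' := by
      ext x y
      apply mul_left_cancel₀ n2
      have q1 := r x y
      have q3 := r' x y
      rw [hφ] at q1
      linarith
    refine ⟨?_, hφ, hψ⟩
    subst hφ hψ
    rw [e] at e'
    ext x y z
    have := congrArg (fun B => B x y z) e'
    simpa only [LinearMap.add_apply, add_left_inj] using this
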